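/- Let n ≥ 3 and let φ : ℝ^{n−1}₊ → ℝ₊ be a twice continuously differentiable function satisfying the homogeneous Monge–Ampère equation det(φ_ij) = 0 at every point of ℝ^{n−1}₊. Then for every twice continuously differentiable function F : ℝ₊ → ℝ with F′ ≠ 0 everywhere, the homothetic function f(x₁,…,xₙ) = F( x₁ · φ(x₂/x₁, …, xₙ/x₁) ) satisfies the homogeneous Monge–Ampère equation det(f_ij) = 0 at every point of ℝⁿ₊. -/

import Mathlib

open Real

/-- Partial derivative of `f` in the `i`-th coordinate direction. -/
noncomputable def pd {n : ℕ} (i : Fin n) (f : (Fin n → ℝ) → ℝ) (x : Fin n → ℝ) : ℝ :=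
  fderiv ℝ f x (Pi.single i 1)

/-- Hessian matrix of second partial derivatives of `f` at `x`. -/
noncomputable def hess {n : ℕ} (f : (Fin n → ℝ) → ℝ) (x : Fin n → ℝ) :
    Matrix (Fin n) (Fin n) ℝ :=
  fun i j => pd i (pd j f) x

/-- Hessian determinant `det(f_ij)` of `f` at `x`. -/
noncomputable def hessDet {n : ℕ} (f : (Fin n → ℝ) → ℝ) (x : Fin n → ℝ) : ℝ :=
  (hess f x).det

/-- The open positive orthant `ℝⁿ₊`. -/
def posOrth (n : ℕ) : Set (Fin n → ℝ) := {x | ∀ i, 0 < x i}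

lemma posOrth_isOpen (n : ℕ) : IsOpen (posOrth n) := by
  have : posOrth n = ⋂ i, {x : Fin n → ℝ | 0 < x i} := by
    ext x; simp [posOrth]
  rw [this]
  exact isOpen_iInter_of_finite fun i => isOpen_lt continuous_const (continuous_apply i)

lemma fderiv_diff_of_C2 {n : ℕ} {f : (Fin n → ℝ) → ℝ} {x : Fin n → ℝ}
    (hf : ContDiffAt ℝ 2 f x) : DifferentiableAt ℝ (fderiv ℝ f) x := by
  have h1 : ContDiffAt ℝ 1 (fderiv ℝ f) x := hf.fderiv_right (by norm_num)
  exact h1.differentiableAt (by norm_num)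

lemma hess_mulVec {n : ℕ} {f : (Fin n → ℝ) → ℝ} {x : Fin n → ℝ}
    (hf : ContDiffAt ℝ 2 f x) (v : Fin n → ℝ) (i : Fin n) :
    (hess f x).mulVec v i = fderiv ℝ (fderiv ℝ f) x (Pi.single i 1) v := by
  have hd := fderiv_diff_of_C2 hf
  have key : ∀ j, hess f x i j
      = fderiv ℝ (fderiv ℝ f) x (Pi.single i 1) (Pi.single j 1) := by
    intro j
    have h := hd.hasFDerivAt.clm_apply (hasFDerivAt_const (Pi.single j (1 : ℝ) : Fin n → ℝ) x)
    have h2 : fderiv ℝ (pd j f) x = _ := h.fderiv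
    simp only [hess]
    unfold pd at h2 ⊢
    rw [h2]
    simp
  have hv : v = ∑ j, v j • (Pi.single j (1 : ℝ) : Fin n → ℝ) := by
    ext k
    simp [Finset.sum_apply, Pi.single_apply]
  conv_rhs => rw [hv, map_sum]
  simp only [Matrix.mulVec, dotProduct, key, map_smul, smul_eq_mul]
  exact Finset.sum_congr rfl fun j _ => mul_comm _ _

lemma clm_zero_of_basis {n : ℕ} (L : (Fin n → ℝ) →L[ℝ] ℝ)
    (h : ∀ i, L (Pi.single i 1) = 0) : L = 0 := by
  refine ContinuousLinearMap.coe_injective ((Pi.basisFun ℝ (Fin n)).ext fun i => ?_)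
  simpa using h i

/-- For `n = m + 1 ≥ 3` and a C² function `φ : ℝ^{n−1}₊ → ℝ₊` with
`det(φ_ij) = 0` everywhere, for every C² function `F : ℝ₊ → ℝ` with `F′ ≠ 0` everywhere,
the homothetic function `f(x₁,…,xₙ) = F(x₁·φ(x₂/x₁,…,xₙ/x₁))` satisfies
`det(f_ij) = 0` at every point of `ℝⁿ₊`. -/
theorem stmt_4 {m : ℕ} (hm : 3 ≤ m + 1)
    (φ : (Fin m → ℝ) → ℝ)
    (hφC2 : ContDiffOn ℝ 2 φ (posOrth m))
    (hφpos : ∀ u ∈ posOrth m, 0 < φ u)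
    (hφMA : ∀ u ∈ posOrth m, hessDet φ u = 0)
    (F : ℝ → ℝ) (hFC2 : ContDiffOn ℝ 2 F (Set.Ioi (0 : ℝ)))
    (hF' : ∀ u : ℝ, 0 < u → deriv F u ≠ 0) :
    ∀ x ∈ posOrth (m + 1),
      hessDet (fun y => F (y 0 * φ (fun i => y i.succ / y 0))) x = 0 := by
  intro x hx
  let U : (Fin (m+1) → ℝ) → (Fin m → ℝ) := fun y i => y i.succ / y 0
  have hU : ∀ y ∈ posOrth (m+1), U y ∈ posOrth m := fun y hy i => div_pos (hy _) (hy _)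
  have hφat : ∀ u ∈ posOrth m, ContDiffAt ℝ 2 φ u := fun u hu =>
    hφC2.contDiffAt ((posOrth_isOpen m).mem_nhds hu)
  have hUat : ∀ y ∈ posOrth (m+1), ContDiffAt ℝ 2 U y := by
    intro y hy
    refine contDiffAt_pi.2 fun i => ?_
    exact (contDiff_apply ℝ ℝ i.succ).contDiffAt.div (contDiff_apply ℝ ℝ 0).contDiffAt (hy 0).ne'
  have hhat : ∀ y ∈ posOrth (m+1), ContDiffAt ℝ 2 (fun y => y 0 * φ (U y)) y := by
    intro y hy
    exact (contDiff_apply ℝ ℝ 0).contDiffAt.mul ((hφat _ (hU y hy)).comp y (hUat y hy))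
  have hhpos : ∀ y ∈ posOrth (m+1), 0 < y 0 * φ (U y) := fun y hy =>
    mul_pos (hy 0) (hφpos _ (hU y hy))
  have hFat : ∀ t : ℝ, 0 < t → ContDiffAt ℝ 2 F t := fun t ht =>
    hFC2.contDiffAt (isOpen_Ioi.mem_nhds ht)
  have hfat : ContDiffAt ℝ 2 (fun y => F (y 0 * φ (U y))) x :=
    (hFat _ (hhpos x hx)).comp x (hhat x hx)
  -- first derivative
  have hUd : ∀ y ∈ posOrth (m+1), ∀ v, fderiv ℝ U y v
      = (y 0)⁻¹ • (fun i : Fin m => v i.succ - v 0 * U y i) := by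
    intro y hy v
    have hy0 : y 0 ≠ 0 := (hy 0).ne'
    have : HasFDerivAt U (fderiv ℝ U y) y :=
      ((hUat y hy).differentiableAt (by norm_num)).hasFDerivAt
    ext i
    have h1 : HasFDerivAt (fun y => U y i)
      ((ContinuousLinearMap.proj i).comp (fderiv ℝ U y)) y := hasFDerivAt_pi'.1 this i
    have h0 : HasFDerivAt (fun z : Fin (m+1) → ℝ => z 0)
        (ContinuousLinearMap.proj (R := ℝ) (φ := fun _ : Fin (m+1) => ℝ) 0) y :=
      hasFDerivAt_apply 0 y
    have hs : HasFDerivAt (fun z : Fin (m+1) → ℝ => z i.succ)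
        (ContinuousLinearMap.proj (R := ℝ) (φ := fun _ : Fin (m+1) => ℝ) i.succ) y :=
      hasFDerivAt_apply i.succ y
    have h2 := (h1.mul h0).congr_of_eventuallyEq (f₁ := fun z => z i.succ) (by
      filter_upwards [(posOrth_isOpen (m+1)).mem_nhds hy] with z hz
      have hz0 : z 0 ≠ 0 := (hz 0).ne'
      simp [U, hz0])
    have h3 := congrArg (fun L => L v) (hs.unique h2)
    simp at h3
    simp only [Pi.smul_apply, smul_eq_mul]
    rw [h3]
    field_simp
    ring
  have hfd : ∀ y ∈ posOrth (m+1), ∀ v, fderiv ℝ (fun y => F (y 0 * φ (U y))) y v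
      = deriv F (y 0 * φ (U y)) *
        (v 0 * φ (U y) + fderiv ℝ φ (U y) (fun i : Fin m => v i.succ - v 0 * U y i)) := by
    intro y hy v
    have hy0 : y 0 ≠ 0 := (hy 0).ne'
    have h1 : HasFDerivAt U (fderiv ℝ U y) y :=
      ((hUat y hy).differentiableAt (by norm_num)).hasFDerivAt
    have h2 : HasFDerivAt φ (fderiv ℝ φ (U y)) (U y) :=
      ((hφat _ (hU y hy)).differentiableAt (by norm_num)).hasFDerivAt
    have h3 := (hasFDerivAt_apply (𝕜 := ℝ) (F' := fun _ : Fin (m+1) => ℝ) 0 y).mul (h2.comp y h1)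
    have h4 : HasDerivAt F (deriv F (y 0 * φ (U y))) (y 0 * φ (U y)) :=
      ((hFat _ (hhpos y hy)).differentiableAt (by norm_num)).hasDerivAt
    have h5 : HasFDerivAt (fun y => F (y 0 * φ (U y))) _ y := h4.comp_hasFDerivAt y h3
    rw [h5.fderiv]
    simp [hUd y hy v]
    field_simp
    ring
  -- kernel vector
  obtain ⟨w, hw0, hw⟩ := Matrix.exists_mulVec_eq_zero_iff.2 (hφMA (U x) (hU x hx))
  have hφ2 : ∀ e, fderiv ℝ (fderiv ℝ φ) (U x) e w = 0 := by
    intro e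
    have : (fderiv ℝ (fderiv ℝ φ) (U x)).flip w = 0 := by
      apply clm_zero_of_basis
      intro i
      rw [ContinuousLinearMap.flip_apply, ← hess_mulVec (hφat _ (hU x hx)), hw]; rfl
    simpa using congrArg (fun L => L e) this
  have hx0 : x 0 ≠ 0 := (hx 0).ne'
  have hφ0 : φ (U x) ≠ 0 := (hφpos _ (hU x hx)).ne'
  set a : ℝ := - fderiv ℝ φ (U x) w / (x 0 * φ (U x)) with ha
  let v : Fin (m+1) → ℝ := Fin.cons (a * x 0) (fun i => a * x i.succ + w i)
  have hv0 : v 0 = a * x 0 := rfl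
  have hvs : ∀ i : Fin m, v i.succ = a * x i.succ + w i := fun i => rfl
  have hvne : v ≠ 0 := by
    intro h
    have h0 : a = 0 := by
      have := congrFun h 0
      rw [hv0] at this
      simpa [hx0] using this
    apply hw0
    ext i
    have := congrFun h i.succ
    rw [hvs, h0] at this
    simpa using this
  have hvw : (fun i : Fin m => v i.succ - v 0 * U x i) = w := by
    ext i
    simp only [hvs, hv0, U]
    field_simp
    ring
  refine Matrix.exists_mulVec_eq_zero_iff.1 ⟨v, hvne, ?_⟩
  ext i
  rw [hess_mulVec hfat]
  have hfd2 := fderiv_diff_of_C2 hfat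
  have hA := hfd2.hasFDerivAt.clm_apply (hasFDerivAt_const v x)
  -- derivative of g
  have hg : HasFDerivAt (fun u : Fin m → ℝ => v 0 * φ u
      + fderiv ℝ φ u (fun i : Fin m => v i.succ - v 0 * u i))
      (0 : (Fin m → ℝ) →L[ℝ] ℝ) (U x) := by
    have h2 : HasFDerivAt φ (fderiv ℝ φ (U x)) (U x) :=
      ((hφat _ (hU x hx)).differentiableAt (by norm_num)).hasFDerivAt
    have h3 := (fderiv_diff_of_C2 (hφat _ (hU x hx))).hasFDerivAt
    have h4 : HasFDerivAt (fun u : Fin m → ℝ => (fun i : Fin m => v i.succ) - v 0 • u)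
        (-(v 0 • ContinuousLinearMap.id ℝ (Fin m → ℝ))) (U x) :=
      ((hasFDerivAt_id (U x)).const_smul (v 0)).const_sub _
    have h5 := (h2.const_mul (v 0)).add (h3.clm_apply h4)
    have hvw' : (fun i : Fin m => v i.succ) - v 0 • U x = w := hvw
    refine h5.congr_fderiv ?_
    ext1
    simp [hvw', hφ2]
  have hgx : v 0 * φ (U x)
      + fderiv ℝ φ (U x) (fun i : Fin m => v i.succ - v 0 * U x i) = 0 := by
    rw [hvw, hv0, ha]
    field_simp
    ring
  have hF1 : DifferentiableAt ℝ (deriv F) (x 0 * φ (U x)) := by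
    have : ContDiffAt ℝ 1 (deriv F) (x 0 * φ (U x)) := by
      have h := (hFat _ (hhpos x hx)).fderiv_right (m := 1) (by norm_num)
      exact h.clm_apply contDiffAt_const
    exact this.differentiableAt (by norm_num)
  have hF2 : DifferentiableAt ℝ (fun y => deriv F (y 0 * φ (U y))) x :=
    DifferentiableAt.comp (g := deriv F) x hF1 ((hhat x hx).differentiableAt (by norm_num))
  have hUx : HasFDerivAt U (fderiv ℝ U x) x :=
      ((hUat x hx).differentiableAt (by norm_num)).hasFDerivAt
  have hB := hF2.hasFDerivAt.mul (hg.comp x hUx)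
  have hC : HasFDerivAt (fun y => fderiv ℝ (fun y => F (y 0 * φ (U y))) y v) _ x :=
    hB.congr_of_eventuallyEq (by
      filter_upwards [(posOrth_isOpen (m+1)).mem_nhds hx] with y hy
      exact hfd y hy v)
  have hD := congrArg (fun L => L (Pi.single i (1:ℝ))) (hA.unique hC)
  simp [hgx] at hD
  simpa using hD
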